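/- Let L be a lattice of rank 2 in the Euclidean plane ℝ² (a discrete free ℤ-submodule of rank 2). Let ω be a nonzero vector of L of minimal Euclidean norm, and let ω' be a vector of minimal Euclidean norm in L ∖ ℤω. Then {ω, ω'} is a ℤ-basis of L, and for all integers m, n one has ‖mω + nω'‖² ≥ (1/2)(m²‖ω‖² + n²‖ω'‖²). -/

import Mathlib

open scoped RealInnerProductSpace

theorem norm_smul_add_smul_sq {E : Type*} [NormedAddCommGroup E] [InnerProductSpace ℝ E]
    (x y : E) (s t : ℝ) :
    ‖s • x + t • y‖ ^ 2 = s ^ 2 * ‖x‖ ^ 2 + 2 * s * t * ⟪x, y⟫ + t ^ 2 * ‖y‖ ^ 2 := by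
  rw [norm_add_sq_real, norm_smul, norm_smul, real_inner_smul_left, real_inner_smul_right,
    mul_pow, mul_pow, Real.norm_eq_abs, Real.norm_eq_abs, sq_abs, sq_abs]
  ring

/-- If `y` is no longer than `y ± x`, then `2|⟪x, y⟫| ≤ ‖x‖²`. -/
theorem two_mul_abs_inner_le_norm_sq {E : Type*} [NormedAddCommGroup E] [InnerProductSpace ℝ E]
    {x y : E} (hadd : ‖y‖ ≤ ‖y + x‖) (hsub : ‖y‖ ≤ ‖y - x‖) : 2 * |⟪x, y⟫| ≤ ‖x‖ ^ 2 := by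
  have h₁ := pow_le_pow_left₀ (norm_nonneg y) hadd 2
  have h₂ := pow_le_pow_left₀ (norm_nonneg y) hsub 2
  rw [norm_add_sq_real, real_inner_comm] at h₁
  rw [norm_sub_sq_real, real_inner_comm] at h₂
  rcases abs_cases ⟪x, y⟫ with h | h <;> linarith

theorem half_le_norm_smul_add_smul_sq {E : Type*} [NormedAddCommGroup E] [InnerProductSpace ℝ E]
    {x y : E} (hxy : ‖x‖ ^ 2 ≤ ‖y‖ ^ 2) (hinner : 2 * |⟪x, y⟫| ≤ ‖x‖ ^ 2) (s t : ℝ) :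
    1 / 2 * (s ^ 2 * ‖x‖ ^ 2 + t ^ 2 * ‖y‖ ^ 2) ≤ ‖s • x + t • y‖ ^ 2 := by
  rw [norm_smul_add_smul_sq]
  obtain ⟨h₁, h₂⟩ := abs_le.mp (show |⟪x, y⟫| ≤ ‖x‖ ^ 2 / 2 by linarith)
  nlinarith [mul_nonneg (sq_nonneg t) (sub_nonneg.mpr hxy),
    mul_nonneg (sq_nonneg (s + t)) (neg_le_iff_add_nonneg.mp h₁),
    mul_nonneg (sq_nonneg (s - t)) (sub_nonneg.mpr h₂)]

theorem norm_smul_add_smul_sq_lt {E : Type*} [NormedAddCommGroup E] [InnerProductSpace ℝ E]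
    {x y : E} (hx : 0 < ‖x‖ ^ 2) (hxy : ‖x‖ ^ 2 ≤ ‖y‖ ^ 2) (hinner : 2 * |⟪x, y⟫| ≤ ‖x‖ ^ 2)
    {s t : ℝ} (hs : |s| ≤ 1 / 2) (ht : |t| ≤ 1 / 2) : ‖s • x + t • y‖ ^ 2 < ‖y‖ ^ 2 := by
  rw [norm_smul_add_smul_sq]
  have hs2 : s ^ 2 ≤ 1 / 4 := by nlinarith [sq_abs s, abs_nonneg s]
  have ht2 : t ^ 2 ≤ 1 / 4 := by nlinarith [sq_abs t, abs_nonneg t]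
  have hst : 2 * s * t * ⟪x, y⟫ ≤ 1 / 4 * ‖x‖ ^ 2 := by
    have h₁ : |s| * |t| ≤ 1 / 2 * (1 / 2) := by gcongr
    have h₂ : |s| * |t| * |⟪x, y⟫| ≤ 1 / 2 * (1 / 2) * |⟪x, y⟫| := by gcongr
    have h₃ := le_abs_self (s * t * ⟪x, y⟫)
    rw [abs_mul, abs_mul] at h₃
    linarith
  have h₁ := mul_le_mul_of_nonneg_right hs2 hx.le
  have h₂ := mul_le_mul_of_nonneg_right ht2 (sq_nonneg ‖y‖)
  linarith

/-- Two vectors of the plane for which Cauchy–Schwarz is strict span it over `ℝ`. -/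
theorem exists_eq_smul_add_smul {x y : EuclideanSpace ℝ (Fin 2)}
    (h : ⟪x, y⟫ ^ 2 < ‖x‖ ^ 2 * ‖y‖ ^ 2) (z : EuclideanSpace ℝ (Fin 2)) :
    ∃ a b : ℝ, z = a • x + b • y := by
  have hdet : x 0 * y 1 - x 1 * y 0 ≠ 0 := by
    intro h0
    simp only [EuclideanSpace.norm_sq_eq, PiLp.inner_apply, Fin.sum_univ_two, Real.norm_eq_abs,
      sq_abs, RCLike.inner_apply, conj_trivial] at h
    have h1 : (x 0 * y 1 - x 1 * y 0) ^ 2 = 0 := by rw [h0]; ring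
    linarith
  refine ⟨(z 0 * y 1 - z 1 * y 0) / (x 0 * y 1 - x 1 * y 0),
    (x 0 * z 1 - x 1 * z 0) / (x 0 * y 1 - x 1 * y 0), ?_⟩
  ext i
  fin_cases i <;>
  · simp only [Fin.zero_eta, Fin.mk_one, PiLp.add_apply, PiLp.smul_apply, smul_eq_mul]
    rw [div_mul_eq_mul_div, div_mul_eq_mul_div, ← add_div, eq_div_iff hdet]
    ring


/-- Let `L` be a rank-2 lattice (discrete free ℤ-submodule of rank 2) in the
Euclidean plane, `ω` a nonzero vector of `L` of minimal norm, and `ω'` a vector of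
minimal norm in `L ∖ ℤω`. Then `{ω, ω'}` is a ℤ-basis of `L`, and
`‖mω + nω'‖² ≥ (1/2)(m²‖ω‖² + n²‖ω'‖²)` for all integers `m, n`. -/
theorem shortest_vectors_basis (L : Submodule ℤ (EuclideanSpace ℝ (Fin 2)))
    (hdisc : DiscreteTopology L) (bL : Module.Basis (Fin 2) ℤ L)
    (ω : EuclideanSpace ℝ (Fin 2)) (hωL : ω ∈ L) (hω0 : ω ≠ 0)
    (hωmin : ∀ x ∈ L, x ≠ 0 → ‖ω‖ ≤ ‖x‖)
    (ω' : EuclideanSpace ℝ (Fin 2)) (hω'L : ω' ∈ L) (hω'0 : ¬ ∃ n : ℤ, ω' = n • ω)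
    (hω'min : ∀ x ∈ L, (¬ ∃ n : ℤ, x = n • ω) → ‖ω'‖ ≤ ‖x‖) :
    (∃ b : Module.Basis (Fin 2) ℤ L, ((b 0 : L) : EuclideanSpace ℝ (Fin 2)) = ω ∧
        ((b 1 : L) : EuclideanSpace ℝ (Fin 2)) = ω') ∧
      ∀ m n : ℤ, ‖m • ω + n • ω'‖^2 ≥
        (1/2) * ((m : ℝ)^2 * ‖ω‖^2 + (n : ℝ)^2 * ‖ω'‖^2) := by
  have hA : 0 < ‖ω‖ ^ 2 := by positivity
  have hω'ne : ω' ≠ 0 := fun h => hω'0 ⟨0, by simp [h]⟩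
  have hAB : ‖ω‖ ^ 2 ≤ ‖ω'‖ ^ 2 := by
    gcongr
    exact hωmin ω' hω'L hω'ne
  have hC : 2 * |⟪ω, ω'⟫| ≤ ‖ω‖ ^ 2 := by
    refine two_mul_abs_inner_le_norm_sq
      (hω'min _ (L.add_mem hω'L hωL) ?_) (hω'min _ (L.sub_mem hω'L hωL) ?_)
    · rintro ⟨n, hn⟩
      exact hω'0 ⟨n - 1, by rw [sub_smul, one_smul, ← hn, add_sub_cancel_right]⟩
    · rintro ⟨n, hn⟩
      exact hω'0 ⟨n + 1, by rw [add_smul, one_smul, ← hn, sub_add_cancel]⟩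
  have hquad (m n : ℤ) : 1 / 2 * ((m : ℝ) ^ 2 * ‖ω‖ ^ 2 + (n : ℝ) ^ 2 * ‖ω'‖ ^ 2) ≤
      ‖m • ω + n • ω'‖ ^ 2 := by
    rw [← Int.cast_smul_eq_zsmul ℝ m, ← Int.cast_smul_eq_zsmul ℝ n]
    exact half_le_norm_smul_add_smul_sq hAB hC m n
  have hspan (x : EuclideanSpace ℝ (Fin 2)) (hx : x ∈ L) : ∃ m n : ℤ, m • ω + n • ω' = x := by
    have hCS : ⟪ω, ω'⟫ ^ 2 < ‖ω‖ ^ 2 * ‖ω'‖ ^ 2 := by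
      nlinarith [sq_abs ⟪ω, ω'⟫, abs_nonneg ⟪ω, ω'⟫]
    obtain ⟨a, b, rfl⟩ := exists_eq_smul_add_smul hCS x
    have hlt := norm_smul_add_smul_sq_lt hA hAB hC (abs_sub_round a) (abs_sub_round b)
    have heq : (a - round a) • ω + (b - round b) • ω' =
        a • ω + b • ω' - (round a • ω + round b • ω') := by
      rw [sub_smul, sub_smul, Int.cast_smul_eq_zsmul, Int.cast_smul_eq_zsmul]
      abel
    rw [heq] at hlt
    have hmem : a • ω + b • ω' - (round a • ω + round b • ω') ∈ L :=
      L.sub_mem hx (L.add_mem (L.smul_mem _ hωL) (L.smul_mem _ hω'L))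
    obtain ⟨k, hk⟩ : ∃ k : ℤ, a • ω + b • ω' - (round a • ω + round b • ω') = k • ω := by
      by_contra hk
      exact absurd (pow_le_pow_left₀ (norm_nonneg _) (hω'min _ hmem hk) 2) hlt.not_ge
    refine ⟨k + round a, round b, ?_⟩
    rw [add_smul, ← hk]
    abel
  refine ⟨?_, hquad⟩
  have hli : LinearIndependent ℤ ![(⟨ω, hωL⟩ : L), ⟨ω', hω'L⟩] := by
    refine LinearIndependent.pair_iff.mpr fun m n hmn => ?_
    have h0 : m • ω + n • ω' = 0 := congrArg Subtype.val hmn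
    have hle := hquad m n
    rw [h0, norm_zero] at hle
    have hm : 0 ≤ (m : ℝ) ^ 2 * ‖ω‖ ^ 2 := by positivity
    have hn : 0 ≤ (n : ℝ) ^ 2 * ‖ω'‖ ^ 2 := by positivity
    have hm0 : (m : ℝ) ^ 2 * ‖ω‖ ^ 2 = 0 := by linarith
    have hn0 : (n : ℝ) ^ 2 * ‖ω'‖ ^ 2 = 0 := by linarith
    constructor
    · simpa [hω0] using hm0
    · simpa [hω'ne] using hn0
  have htop : ⊤ ≤ Submodule.span ℤ (Set.range ![(⟨ω, hωL⟩ : L), ⟨ω', hω'L⟩]) := by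
    rintro ⟨x, hx⟩ -
    obtain ⟨m, n, h⟩ := hspan x hx
    rw [Matrix.range_cons_cons_empty, Submodule.mem_span_pair]
    exact ⟨m, n, Subtype.ext h⟩
  exact ⟨Module.Basis.mk hli htop, by simp, by simp⟩
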